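/- arXiv:2109.14999 — 2 statements merged into one kernel-verified Lean document; each statement's English description precedes it below -/
import Mathlib

section
/- Let N ≥ 2 and let z_{1,N} > z_{2,N} > ... > z_{N,N} be the ordered roots of the Hermite polynomial H_N. Then for every i ∈ {1,...,N}, Σ_{l ≠ i} 1/(z_{i,N} − z_{l,N})⁴ ≤ (N−1)³/(2N) ≤ (N−1)²/2. -/
/-- The physicists' Hermite polynomials, orthogonal w.r.t. the weight `exp(-x²)` on `ℝ`:
`H_0 = 1`, `H_1 = 2X`, `H_{n+2} = 2X·H_{n+1} - 2(n+1)·H_n`. -/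
noncomputable def hermiteP : ℕ → Polynomial ℝ
  | 0 => 1
  | 1 => 2 * Polynomial.X
  | n + 2 => 2 * Polynomial.X * hermiteP (n + 1) - Polynomial.C (2 * ((n : ℝ) + 1)) * hermiteP n

open Polynomial in
theorem derivative_hermiteP_succ (n : ℕ) :
    derivative (hermiteP (n + 1)) = C (2 * ((n : ℝ) + 1)) * hermiteP n := by
  have two : (2 : ℝ[X]) = C 2 := rfl
  induction n using Nat.strong_induction_on with
  | _ n ih =>
    match n with
    | 0 => simp [hermiteP, two]
    | 1 =>
      simp only [hermiteP, two, derivative_sub, derivative_mul, derivative_C, derivative_X,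
        derivative_one]
      simp only [← two, C_mul, C_add, C_1, Nat.cast_zero, Nat.cast_one, C_0]
      ring
    | n + 2 =>
      have h1 := ih (n + 1) (by omega)
      have h0 := ih n (by omega)
      rw [hermiteP, derivative_sub, derivative_mul, derivative_mul, derivative_mul, h1, h0,
        hermiteP]
      simp only [two, derivative_C, derivative_X]
      simp only [← two, C_mul, C_add, C_1, Nat.cast_add, Nat.cast_ofNat, Nat.cast_one]
      ring

open Polynomial in
theorem hermiteP_differential_equation (n : ℕ) :
    derivative (derivative (hermiteP n)) =
      2 * X * derivative (hermiteP n) - C (2 * (n : ℝ)) * hermiteP n := by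
  match n with
  | 0 => simp [hermiteP]
  | 1 =>
    rw [hermiteP, show (2 : ℝ[X]) = C 2 from rfl]
    simp only [derivative_C_mul, derivative_X, derivative_C, Nat.cast_one, mul_one]
    ring
  | n + 2 =>
    rw [derivative_hermiteP_succ, derivative_C_mul, derivative_hermiteP_succ, hermiteP]
    simp only [C_mul, C_add, C_1, Nat.cast_add, Nat.cast_ofNat, Nat.cast_one,
      show (C 2 : ℝ[X]) = 2 from rfl]
    ring

open Polynomial in
theorem natDegree_hermiteP_le_and_coeff (n : ℕ) :
    (hermiteP n).natDegree ≤ n ∧ (hermiteP n).coeff n = 2 ^ n := by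
  have two : (2 : ℝ[X]) = C 2 := rfl
  induction n using Nat.strong_induction_on with
  | _ n ih =>
    match n with
    | 0 => simp [hermiteP]
    | 1 =>
      rw [hermiteP, two]
      exact ⟨(natDegree_C_mul_le _ _).trans natDegree_X_le, by simp⟩
    | n + 2 =>
      obtain ⟨d1, c1⟩ := ih (n + 1) (by omega)
      obtain ⟨d0, -⟩ := ih n (by omega)
      rw [hermiteP]
      constructor
      · refine (natDegree_sub_le _ _).trans (max_le ?_ ?_)
        · refine natDegree_mul_le.trans ?_
          have := (natDegree_C_mul_le (2 : ℝ) X).trans natDegree_X_le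
          rw [← two] at this
          omega
        · exact (natDegree_C_mul_le _ _).trans (by omega)
      · rw [two, mul_assoc, coeff_sub, coeff_C_mul, coeff_C_mul, coeff_X_mul, c1,
          coeff_eq_zero_of_natDegree_lt (by omega : (hermiteP n).natDegree < n + 2)]
        ring

open Polynomial in
theorem hermiteP_eq_C_mul_prod {N : ℕ} {z : Fin N → ℝ} (hz : Function.Injective z)
    (hroot : ∀ i, (hermiteP N).eval (z i) = 0) :
    hermiteP N = C (2 ^ N) * ∏ l, (X - C (z l)) := by
  obtain ⟨hd, hc⟩ := natDegree_hermiteP_le_and_coeff N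
  have hP : (∏ l, (X - C (z l))).Monic := monic_prod_of_monic _ _ fun l _ => monic_X_sub_C _
  have hPd : (∏ l, (X - C (z l))).natDegree = N := by simp
  have hdvd : (∏ l, (X - C (z l))) ∣ hermiteP N :=
    Finset.prod_dvd_of_coprime
      (fun a _ b _ hab => pairwise_coprime_X_sub_C hz hab)
      fun l _ => dvd_iff_isRoot.2 (hroot l)
  have hlead : (hermiteP N).leadingCoeff = 2 ^ N := by
    rw [leadingCoeff, le_antisymm hd (le_natDegree_of_ne_zero (by rw [hc]; positivity)), hc]
  rw [← hlead, mul_comm]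
  exact eq_mul_leadingCoeff_of_monic_of_dvd_of_natDegree_le hP hdvd (hd.trans hPd.ge)

open Polynomial in
/-- The first four derivatives of a product of linear factors, expressed through the power sums
of the reciprocals of its factors. -/
theorem eval_derivatives_prod_X_sub_C {ι : Type*} [DecidableEq ι] (s : Finset ι) (a : ι → ℝ)
    (x : ℝ) (hx : ∀ l ∈ s, x - a l ≠ 0) :
    let G := ∏ l ∈ s, (X - C (a l))
    let S := fun k : ℕ => ∑ l ∈ s, ((x - a l) ^ k)⁻¹
    (derivative G).eval x = S 1 * G.eval x ∧
    (derivative (derivative G)).eval x = (S 1 ^ 2 - S 2) * G.eval x ∧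
    (derivative (derivative (derivative G))).eval x =
      (S 1 ^ 3 - 3 * S 1 * S 2 + 2 * S 3) * G.eval x ∧
    (derivative (derivative (derivative (derivative G)))).eval x =
      (S 1 ^ 4 - 6 * S 1 ^ 2 * S 2 + 3 * S 2 ^ 2 + 8 * S 1 * S 3 - 6 * S 4) * G.eval x := by
  induction s using Finset.induction_on with
  | empty => simp
  | insert j s hj ih =>
    obtain ⟨h1, h2, h3, h4⟩ := ih fun l hl => hx l (Finset.mem_insert_of_mem hl)
    have hr := hx j (Finset.mem_insert_self j s)
    simp only [Finset.prod_insert hj, Finset.sum_insert hj]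
    simp only [derivative_mul, derivative_add, derivative_sub, derivative_X, derivative_C,
      sub_zero, one_mul, eval_add, eval_mul, eval_sub, eval_X, eval_C, h1, h2, h3, h4]
    generalize x - a j = r at hr
    refine ⟨?_, ?_, ?_, ?_⟩ <;> field_simp <;> ring

open Polynomial in
theorem hermiteP_roots_power_sums {N : ℕ} {z : Fin N → ℝ} (hz : Function.Injective z)
    (hroot : ∀ i, (hermiteP N).eval (z i) = 0) (i : Fin N) :
    ∑ l ∈ Finset.univ.erase i, ((z i - z l) ^ 2)⁻¹ = (2 * ((N : ℝ) - 1) - z i ^ 2) / 3 ∧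
    ∑ l ∈ Finset.univ.erase i, ((z i - z l) ^ 4)⁻¹ =
      (z i ^ 4 - 4 * ((N : ℝ) - 1) * z i ^ 2 - 6 * z i ^ 2 + 4 * ((N : ℝ) - 1) ^ 2
        + 12 * ((N : ℝ) - 1)) / 45 := by
  have hne : ∀ l ∈ Finset.univ.erase i, z i - z l ≠ 0 := fun l hl =>
    sub_ne_zero.2 fun h => Finset.ne_of_mem_erase hl (hz h).symm
  have hG : (∏ l ∈ Finset.univ.erase i, (X - C (z l))).eval (z i) ≠ 0 := by
    rw [eval_prod]
    exact Finset.prod_ne_zero_iff.2 fun l hl => by simpa using hne l hl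
  obtain ⟨e1, e2, e3, e4⟩ := eval_derivatives_prod_X_sub_C _ z (z i) hne
  beta_reduce at e1 e2 e3 e4
  have hode := hermiteP_differential_equation N
  rw [hermiteP_eq_C_mul_prod hz hroot, ← Finset.mul_prod_erase _ _ (Finset.mem_univ i)] at hode
  revert hG e1 e2 e3 e4 hode
  generalize (∏ l ∈ Finset.univ.erase i, (X - C (z l))) = G
  generalize z i = x
  intro hG e1 e2 e3 e4 hode
  have hc : (2 : ℝ) ^ N ≠ 0 := by positivity
  generalize (2 : ℝ) ^ N = c at hc hode
  have o1 := congrArg (eval x) hode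
  have o2 := congrArg (fun p => eval x (derivative p)) hode
  have o3 := congrArg (fun p => eval x (derivative (derivative p))) hode
  have o4 := congrArg (fun p => eval x (derivative (derivative (derivative p)))) hode
  simp only [show (2 : ℝ[X]) = C 2 from rfl, derivative_mul, derivative_add, derivative_sub,
    derivative_X, derivative_C, sub_zero, zero_mul, mul_zero, zero_add, add_zero, one_mul, mul_one, eval_add, eval_mul, eval_sub, eval_X, eval_C, sub_self,
    e1, e2, e3, e4] at o1 o2 o3 o4
  generalize eval x G = g at *
  have hcg : c * g ≠ 0 := mul_ne_zero hc hG
  generalize ∑ l ∈ Finset.univ.erase i, ((x - z l) ^ 1)⁻¹ = S1 at *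
  generalize ∑ l ∈ Finset.univ.erase i, ((x - z l) ^ 2)⁻¹ = S2 at *
  generalize ∑ l ∈ Finset.univ.erase i, ((x - z l) ^ 3)⁻¹ = S3 at *
  generalize ∑ l ∈ Finset.univ.erase i, ((x - z l) ^ 4)⁻¹ = S4 at *
  have r1 : S1 = x := mul_left_cancel₀ hcg (by linear_combination o1 / 2)
  subst r1
  have r2 : S2 = (2 * ((N : ℝ) - 1) - S1 ^ 2) / 3 :=
    mul_left_cancel₀ hcg (by linear_combination -o2 / 3)
  subst r2
  have r3 : S3 = S1 / 2 := mul_left_cancel₀ hcg (by linear_combination o3 / 8)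
  subst r3
  exact ⟨rfl, mul_left_cancel₀ hcg (by linear_combination -o4 / 30)⟩

/-- For the ordered roots `z 0 > z 1 > … > z (N-1)` of the Hermite
polynomial `H_N` (`N ≥ 2`), for every `i`,
`∑_{l ≠ i} 1/(z i - z l)⁴ ≤ (N-1)³/(2N) ≤ (N-1)²/2`. -/
theorem hermite_roots_fourth_power_sum_le
    (N : ℕ) (hN : 2 ≤ N) (z : Fin N → ℝ) (hz : StrictAnti z)
    (hroot : ∀ i, (hermiteP N).eval (z i) = 0) (i : Fin N) :
    (∑ l ∈ Finset.univ.erase i, ((z i - z l) ^ 4)⁻¹ ≤ ((N : ℝ) - 1) ^ 3 / (2 * N))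
      ∧ ((N : ℝ) - 1) ^ 3 / (2 * N) ≤ ((N : ℝ) - 1) ^ 2 / 2 := by
  have hN' : (2 : ℝ) ≤ N := by exact_mod_cast hN
  constructor
  · obtain ⟨h2, h4⟩ := hermiteP_roots_power_sums hz.injective hroot i
    have hS2 : 0 ≤ ∑ l ∈ Finset.univ.erase i, ((z i - z l) ^ 2)⁻¹ :=
      Finset.sum_nonneg fun l _ => by positivity
    rw [h2] at hS2
    have hw : z i ^ 2 ≤ 2 * ((N : ℝ) - 1) := by linarith
    rw [h4]
    rcases hN.eq_or_lt with rfl | h3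
    · have hr := hroot i
      simp [hermiteP] at hr
      have hw' : z i ^ 2 = 1 / 2 := by linear_combination hr / 4
      rw [show z i ^ 4 = (z i ^ 2) ^ 2 by ring, hw']
      norm_num
    · have h3' : (3 : ℝ) ≤ N := by exact_mod_cast h3
      rw [div_le_div_iff₀ (by norm_num) (by positivity)]
      have hA : z i ^ 4 - 4 * ((N : ℝ) - 1) * z i ^ 2 - 6 * z i ^ 2 ≤ 0 := by
        nlinarith [sq_nonneg (z i), mul_nonneg (sq_nonneg (z i)) (sub_nonneg.2 hw)]
      obtain ⟨t, ht, hNt⟩ : ∃ t : ℝ, 0 ≤ t ∧ (N : ℝ) = t + 3 := ⟨N - 3, by linarith, by ring⟩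
      have hB : (4 * ((N : ℝ) - 1) ^ 2 + 12 * ((N : ℝ) - 1)) * (2 * N) ≤ ((N : ℝ) - 1) ^ 3 * 45 := by
        rw [hNt, ← sub_nonneg]
        ring_nf
        positivity
      nlinarith
  · rw [div_le_div_iff₀ (by positivity) (by norm_num)]
    nlinarith [sq_nonneg ((N : ℝ) - 1)]
end

section
/- Let ν > 0, N ≥ 2, and let z_{1,N} > ... > z_{N,N} > 0 be the ordered roots of the Laguerre polynomial L_N^{(ν−1)}. Then for every i ∈ {1,...,N−1}, z_{i,N} − z_{i+1,N} ≥ sqrt(2(1 + sqrt(1 + 8ν²)))/(2N−1) ≥ 2·2^{1/4}·sqrt(ν)/(2N−1). -/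
/-- The generalized Laguerre polynomials `L_n^{(a)}`, orthogonal w.r.t. the weight
`exp(-x)·x^a` on `(0,∞)` (for `a > -1`), defined via the standard three-term recurrence
`L_0^{(a)} = 1`, `L_1^{(a)} = 1 + a - X`,
`(n+2)·L_{n+2}^{(a)} = (2(n+1)+1+a-X)·L_{n+1}^{(a)} - (n+1+a)·L_n^{(a)}`. -/
noncomputable def laguerreP (a : ℝ) : ℕ → Polynomial ℝ
  | 0 => 1
  | 1 => Polynomial.C (1 + a) - Polynomial.X
  | n + 2 =>
      Polynomial.C (1 / ((n : ℝ) + 2)) *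
        ((Polynomial.C (2 * ((n : ℝ) + 1) + 1 + a) - Polynomial.X) * laguerreP a (n + 1)
          - Polynomial.C (((n : ℝ) + 1) + a) * laguerreP a n)

open Polynomial in
/-- Multiplicative form of the three-term recurrence defining `laguerreP`. -/
theorem laguerreP_recurrence (a : ℝ) (n : ℕ) :
    C ((n : ℝ) + 2) * laguerreP a (n + 2) =
      (C (2 * ((n : ℝ) + 1) + 1 + a) - X) * laguerreP a (n + 1)
        - C (((n : ℝ) + 1) + a) * laguerreP a n := by
  have h : (n : ℝ) + 2 ≠ 0 := by positivity
  rw [laguerreP, ← mul_assoc, ← C_mul, mul_one_div_cancel h, C_1, one_mul]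

open Polynomial in
theorem laguerreP_derivative_succ (a : ℝ) (n : ℕ) :
    X * derivative (laguerreP a (n + 1)) =
        C ((n : ℝ) + 1) * laguerreP a (n + 1) - C ((n : ℝ) + 1 + a) * laguerreP a n ∧
      derivative (laguerreP a (n + 1)) = derivative (laguerreP a n) - laguerreP a n := by
  induction n with
  | zero =>
    constructor
    · simp [laguerreP]
    · simp [laguerreP]
  | succ n ih =>
    obtain ⟨h1, h2⟩ := ih
    have hr := laguerreP_recurrence a n
    have hd := congrArg derivative hr
    have hc : (C ((n : ℝ) + 2) : ℝ[X]) ≠ 0 := C_ne_zero.mpr (by positivity)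
    simp only [derivative_mul, derivative_sub, derivative_C, derivative_X, zero_mul, zero_add,
      zero_sub] at hd
    have hB : derivative (laguerreP a (n + 1 + 1)) =
        derivative (laguerreP a (n + 1)) - laguerreP a (n + 1) := by
      apply mul_left_cancel₀ hc
      simp only [C_add, C_mul, C_1, C_ofNat] at h1 hd ⊢
      linear_combination hd - h1 + (C (n : ℝ) + 1 + C a) * h2
    refine ⟨?_, hB⟩
    push_cast
    simp only [C_add, C_mul, C_1, C_ofNat] at h1 hr ⊢
    linear_combination X * hB + h1 - hr

open Polynomial in
/-- The Laguerre differential equation. -/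
theorem laguerreP_ode (a : ℝ) (n : ℕ) :
    X * derivative (derivative (laguerreP a n)) +
      (C (a + 1) - X) * derivative (laguerreP a n) + C (n : ℝ) * laguerreP a n = 0 := by
  cases n with
  | zero => simp [laguerreP]
  | succ n =>
    obtain ⟨h1, h2⟩ := laguerreP_derivative_succ a n
    have hd := congrArg derivative h1
    simp only [derivative_mul, derivative_sub, derivative_C, derivative_X, zero_mul, zero_add,
      one_mul] at hd
    push_cast
    simp only [C_add, C_1] at h1 hd ⊢
    linear_combination hd - h1 + (C (n : ℝ) + 1 + C a) * h2

open Polynomial in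
theorem laguerreP_natDegree_le (a : ℝ) (n : ℕ) : (laguerreP a n).natDegree ≤ n := by
  induction n using Nat.twoStepInduction with
  | zero => simp [laguerreP]
  | one => rw [laguerreP]; compute_degree
  | more n h0 h1 =>
    rw [laguerreP]
    refine (natDegree_C_mul_le _ _).trans ((natDegree_sub_le_of_le ?_ ?_).trans (max_self (n + 2)).le)
    · refine natDegree_mul_le.trans ?_
      have : (C (2 * ((n : ℝ) + 1) + 1 + a) - X).natDegree ≤ 1 := by compute_degree
      omega
    · exact (natDegree_C_mul_le _ _).trans (by omega)

theorem laguerreP_eval_zero_ne_zero {ν : ℝ} (hν : 0 < ν) (n : ℕ) :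
    (laguerreP (ν - 1) n).eval 0 ≠ 0 := by
  induction n with
  | zero => simp [laguerreP]
  | succ n ih =>
    have h := congrArg (Polynomial.eval 0) (laguerreP_derivative_succ (ν - 1) n).1
    simp only [Polynomial.eval_mul, Polynomial.eval_X, zero_mul, Polynomial.eval_sub,
      Polynomial.eval_C] at h
    intro h0
    rw [h0] at h
    have : ((n : ℝ) + ν) * (laguerreP (ν - 1) n).eval 0 = 0 := by linear_combination h
    have hn : (n : ℝ) + ν ≠ 0 := by positivity
    exact ih ((mul_eq_zero.mp this).resolve_left hn)

open Polynomial in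
/-- A polynomial of degree at most `card ι` vanishing at the points of an injective family
indexed by `ι` is a multiple of the corresponding nodal polynomial. -/
theorem exists_eq_C_mul_prod_X_sub_C {ι : Type*} [Fintype ι] {p : ℝ[X]} {z : ι → ℝ}
    (hz : Function.Injective z) (hdeg : p.natDegree ≤ Fintype.card ι)
    (hroot : ∀ i, p.eval (z i) = 0) : ∃ c : ℝ, p = C c * ∏ i, (X - C (z i)) := by
  have hdvd : ∏ i, (X - C (z i)) ∣ p :=
    Finset.prod_dvd_of_coprime
      (fun i _ j _ hij => pairwise_coprime_X_sub_C hz hij)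
      (fun i _ => dvd_iff_isRoot.mpr (hroot i))
  obtain ⟨s, hs⟩ := hdvd
  rcases eq_or_ne s 0 with rfl | hs0
  · exact ⟨0, by simp [hs]⟩
  have hm : (∏ i, (X - C (z i))).Monic := monic_prod_of_monic _ _ fun i _ => monic_X_sub_C _
  have hd : p.natDegree = Fintype.card ι + s.natDegree := by
    rw [hs, hm.natDegree_mul' hs0, natDegree_prod_of_monic _ _ fun i _ => monic_X_sub_C _]
    simp
  rw [eq_C_of_natDegree_eq_zero (p := s) (by omega), mul_comm] at hs
  exact ⟨_, hs⟩

open Polynomial in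
theorem laguerre_expr_X_sub_C_mul (f : ℝ[X]) (c x : ℝ) :
    (derivative ((X - C c) * f)).eval x ^ 2
        - ((X - C c) * f).eval x * (derivative (derivative ((X - C c) * f))).eval x =
      f.eval x ^ 2 + (x - c) ^ 2 *
        ((derivative f).eval x ^ 2 - f.eval x * (derivative (derivative f)).eval x) := by
  simp only [derivative_mul, derivative_sub, derivative_X, derivative_C, derivative_add,
    eval_add, eval_mul, eval_sub, eval_X, eval_C, sub_zero, one_mul]
  ring

open Polynomial in
/-- Laguerre's inequality for products of real linear factors. -/
theorem laguerre_expr_prod_nonneg {ι : Type*} (s : Finset ι) (z : ι → ℝ) (c x : ℝ) :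
    0 ≤ (derivative (C c * ∏ i ∈ s, (X - C (z i)))).eval x ^ 2
      - (C c * ∏ i ∈ s, (X - C (z i))).eval x *
        (derivative (derivative (C c * ∏ i ∈ s, (X - C (z i))))).eval x := by
  classical
  induction s using Finset.induction_on with
  | empty => simp
  | insert i s hi ih =>
    rw [Finset.prod_insert hi, mul_left_comm, laguerre_expr_X_sub_C_mul]
    positivity

open Polynomial in
/-- A bound on the distance between two roots of a polynomial with simple real roots. -/
theorem sq_derivative_le_of_roots {ι : Type*} [Fintype ι] {p : ℝ[X]} {z : ι → ℝ} {c : ℝ}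
    (hp : p = C c * ∏ i, (X - C (z i))) {i j : ι} (hij : i ≠ j) :
    (derivative p).eval (z i) ^ 2 ≤ (z i - z j) ^ 2 *
      ((derivative (derivative p)).eval (z i) ^ 2 / 4 -
        (derivative p).eval (z i) * (derivative (derivative (derivative p))).eval (z i) / 3) := by
  classical
  set r : ℝ[X] := C c * ∏ k ∈ (Finset.univ.erase i).erase j, (X - C (z k)) with hr
  have hfac : p = (X - C (z i)) * ((X - C (z j)) * r) := by
    rw [hp, ← Finset.mul_prod_erase Finset.univ _ (Finset.mem_univ i),
      ← Finset.mul_prod_erase (Finset.univ.erase i) _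
        (Finset.mem_erase.mpr ⟨hij.symm, Finset.mem_univ j⟩), hr]
    ring
  have hL := laguerre_expr_prod_nonneg ((Finset.univ.erase i).erase j) z c (z i)
  rw [← hr] at hL
  have hq := laguerre_expr_X_sub_C_mul r (z j) (z i)
  have h0 : ((X - C (z j)) * r).eval (z i) = (z i - z j) * r.eval (z i) := by simp
  rw [hfac]
  generalize hqd : (X - C (z j)) * r = q at *
  have h1 : (derivative ((X - C (z i)) * q)).eval (z i) = q.eval (z i) := by simp
  have h2 : (derivative (derivative ((X - C (z i)) * q))).eval (z i)
      = 2 * (derivative q).eval (z i) := by simp; ring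
  have h3 : (derivative (derivative (derivative ((X - C (z i)) * q)))).eval (z i)
      = 3 * (derivative (derivative q)).eval (z i) := by simp; ring
  rw [h1, h2, h3]
  calc q.eval (z i) ^ 2 = (z i - z j) ^ 2 * r.eval (z i) ^ 2 := by rw [h0]; ring
    _ ≤ (z i - z j) ^ 2 * (r.eval (z i) ^ 2 + (z i - z j) ^ 2 *
        ((derivative r).eval (z i) ^ 2 - r.eval (z i) * (derivative (derivative r)).eval (z i))) :=
      mul_le_mul_of_nonneg_left (le_add_of_nonneg_right (mul_nonneg (sq_nonneg _) hL))
        (sq_nonneg _)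
    _ = _ := by rw [← hq]; ring

open Polynomial in
/-- The key estimate for two roots `z i`, `z j` of the Laguerre polynomial. -/
theorem laguerreP_roots_sq_bound {ν : ℝ} (hν : 0 < ν) {N : ℕ} {z : Fin N → ℝ}
    (hz : Function.Injective z) (hroot : ∀ i, (laguerreP (ν - 1) N).eval (z i) = 0)
    {i j : Fin N} (hij : i ≠ j) :
    3 * z i ^ 2 ≤ (z i - z j) ^ 2 * (N * z i - ν) := by
  obtain ⟨c, hc⟩ := exists_eq_C_mul_prod_X_sub_C hz
    (by simpa using laguerreP_natDegree_le (ν - 1) N) hroot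
  have hc0 : c ≠ 0 := by
    rintro rfl
    exact laguerreP_eval_zero_ne_zero hν N (by simp [hc])
  have hD : (derivative (laguerreP (ν - 1) N)).eval (z i) ≠ 0 := by
    rw [hc, derivative_C_mul, eval_C_mul, derivative_prod_finset, eval_finsetSum]
    refine mul_ne_zero hc0 ?_
    rw [Finset.sum_eq_single i]
    · simp only [derivative_X_sub_C, mul_one, eval_prod, eval_sub, eval_X, eval_C]
      exact Finset.prod_ne_zero_iff.mpr fun k hk =>
        sub_ne_zero.mpr (hz.ne (Finset.ne_of_mem_erase hk).symm)
    · intro k _ hk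
      rw [eval_mul, eval_prod, Finset.prod_eq_zero (i := i) (by simp [hk.symm]) (by simp), zero_mul]
    · simp
  have hkey := sq_derivative_le_of_roots hc hij
  have ode := laguerreP_ode (ν - 1) N
  have hode := congrArg (eval (z i)) ode
  have hode' := congrArg (fun p => eval (z i) (derivative p)) ode
  simp only [derivative_mul, derivative_sub, derivative_X, derivative_C, derivative_add,
    eval_add, eval_mul, eval_sub, eval_X, eval_C, one_mul, zero_mul, zero_sub, zero_add,
    eval_neg, eval_zero, derivative_zero, eval_one, hroot i, mul_zero, add_zero] at hode hode'
  generalize eval (z i) (derivative (laguerreP (ν - 1) N)) = y1 at *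
  generalize eval (z i) (derivative (derivative (laguerreP (ν - 1) N))) = y2 at *
  generalize eval (z i) (derivative (derivative (derivative (laguerreP (ν - 1) N)))) = y3 at *
  generalize z i - z j = d at *
  generalize z i = x at *
  have h2 : x * y2 = (x - ν) * y1 := by linear_combination hode
  have h3 : x ^ 2 * y3 = ((x - ν) ^ 2 - (x - ν) - (N - 1) * x) * y1 := by
    linear_combination x * hode' + (x - ν - 1) * h2
  have hS : x ^ 2 * (y2 ^ 2 / 4 - y1 * y3 / 3) =
      y1 ^ 2 * ((N * x - ν) / 3 - (x - ν) ^ 2 / 12) := by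
    linear_combination (x * y2 + (x - ν) * y1) / 4 * h2 - y1 / 3 * h3
  have hx := mul_le_mul_of_nonneg_left hkey (sq_nonneg x)
  have hy : 0 < y1 ^ 2 := by positivity
  have : y1 ^ 2 * x ^ 2 ≤ y1 ^ 2 * (d ^ 2 * ((N * x - ν) / 3 - (x - ν) ^ 2 / 12)) := by
    calc y1 ^ 2 * x ^ 2 = x ^ 2 * y1 ^ 2 := mul_comm _ _
      _ ≤ _ := hx
      _ = _ := by linear_combination d ^ 2 * hS
  have := le_of_mul_le_mul_left this hy
  nlinarith [mul_nonneg (sq_nonneg d) (sq_nonneg (x - ν))]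

/-- For the ordered roots `z 0 > … > z (N-1) > 0` of the Laguerre
polynomial `L_N^{(ν-1)}` (`ν > 0`, `N ≥ 2`), consecutive roots satisfy
`z i - z (i+1) ≥ √(2(1+√(1+8ν²)))/(2N-1) ≥ 2·2^{1/4}·√ν/(2N-1)`. -/
theorem laguerre_roots_gap_ge
    (ν : ℝ) (hν : 0 < ν) (N : ℕ) (hN : 2 ≤ N) (z : Fin N → ℝ)
    (hz : StrictAnti z) (hpos : ∀ i, 0 < z i)
    (hroot : ∀ i, (laguerreP (ν - 1) N).eval (z i) = 0) (i : ℕ) (hi : i + 1 < N) :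
    (z ⟨i, Nat.lt_of_succ_lt hi⟩ - z ⟨i + 1, hi⟩
        ≥ Real.sqrt (2 * (1 + Real.sqrt (1 + 8 * ν ^ 2))) / (2 * (N : ℝ) - 1))
      ∧ Real.sqrt (2 * (1 + Real.sqrt (1 + 8 * ν ^ 2))) / (2 * (N : ℝ) - 1)
          ≥ 2 * (2 : ℝ) ^ ((1 : ℝ) / 4) * Real.sqrt ν / (2 * (N : ℝ) - 1) := by
  set a := z ⟨i, Nat.lt_of_succ_lt hi⟩
  set b := z ⟨i + 1, hi⟩
  have hba : b < a := hz (Fin.mk_lt_mk.mpr (Nat.lt_succ_self i))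
  have hb0 : 0 < b := hpos _
  have ha0 : 0 < a := hb0.trans hba
  have hN' : (2 : ℝ) ≤ N := by exact_mod_cast hN
  have hden : 0 < 2 * (N : ℝ) - 1 := by linarith
  have key : 3 * a ^ 2 ≤ (a - b) ^ 2 * (N * a - ν) :=
    laguerreP_roots_sq_bound hν hz.injective hroot (by simp)
  have hd : 0 < a - b := sub_pos.mpr hba
  have hda : a - b < a := sub_lt_self a hb0
  generalize a - b = d at *
  clear_value a b
  have hsmall : 3 ≤ N * d := by
    have h1 : 3 * a ^ 2 ≤ d ^ 2 * (N * a) := by nlinarith [mul_pos (pow_pos hd 2) hν]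
    have h2 : d ^ 2 * (N * a) ≤ N * d * a ^ 2 := by
      have : 0 ≤ N * d * a * (a - d) :=
        mul_nonneg (by positivity) (sub_nonneg.mpr hda.le)
      nlinarith
    exact le_of_mul_le_mul_right (h1.trans h2) (by positivity)
  have hlarge : 12 * ν ≤ (N * d) ^ 2 := by
    have h2 : 12 * ν * a ^ 2 ≤ (N * d) ^ 2 * a ^ 2 := by
      nlinarith [mul_nonneg (sq_nonneg d) (sq_nonneg (N * a - 2 * ν))]
    exact le_of_mul_le_mul_right h2 (by positivity)
  constructor
  · have ht : Real.sqrt (1 + 8 * ν ^ 2) ≤ 1 + 3 * ν :=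
      Real.sqrt_le_iff.mpr ⟨by positivity, by nlinarith⟩
    refine (div_le_iff₀ hden).mpr (Real.sqrt_le_iff.mpr ⟨by positivity, ?_⟩)
    have h1 : N * d ≤ d * (2 * N - 1) := by nlinarith
    have h2 : (N * d) ^ 2 ≤ (d * (2 * N - 1)) ^ 2 := by gcongr
    nlinarith
  · refine div_le_div_of_nonneg_right (Real.le_sqrt_of_sq_le ?_) hden.le
    have h2 : ((2 : ℝ) ^ ((1 : ℝ) / 4)) ^ 2 = Real.sqrt 2 := by
      rw [← Real.rpow_natCast, ← Real.rpow_mul (by norm_num), Real.sqrt_eq_rpow]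
      norm_num
    have h3 : 2 * Real.sqrt 2 * ν ≤ Real.sqrt (1 + 8 * ν ^ 2) := by
      apply Real.le_sqrt_of_sq_le
      rw [mul_pow, mul_pow, Real.sq_sqrt (by norm_num)]
      linarith
    rw [mul_pow, mul_pow, h2, Real.sq_sqrt hν.le]
    linarith
end
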